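/- arXiv:0811.1067 — 5 statements merged into one kernel-verified Lean document; each statement's English description precedes it below -/
import Mathlib

section
/- Let G=(V,E) be a finite undirected simple graph with positive symmetric edge weights w. Every edge flow X on G admits a decomposition X = g + h + c where: g = grad s for some s : V → ℝ; h is an edge flow with curl h = 0 and div h = 0 (a harmonic flow); c is an edge flow with ⟨c, Z⟩_w = 0 for every curl-free edge flow Z; and g, h, c are pairwise orthogonal with respect to ⟨·,·⟩_w. Moreover the edge flows g, h, c are uniquely determined by X. (Helmholtz decomposition: every pairwise ranking is the orthogonal sum of a globally consistent component, a harmonic component, and a locally cyclic component.) -/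
open Finset

/-- `X` is an edge flow on `G`: skew-symmetric on edges and zero off edges. -/
def IsEdgeFlow {V : Type*} (G : SimpleGraph V) (X : V → V → ℝ) : Prop :=
  (∀ i j, G.Adj i j → X i j = - X j i) ∧ ∀ i j, ¬ G.Adj i j → X i j = 0

/-- The gradient flow of a potential `s` on `G`. -/
noncomputable def gradFlow {V : Type*} (G : SimpleGraph V) [DecidableRel G.Adj]
    (s : V → ℝ) : V → V → ℝ :=
  fun i j => if G.Adj i j then s j - s i else 0

/-- The combinatorial curl of an edge flow on `G`. -/
noncomputable def curlFlow {V : Type*} (G : SimpleGraph V) [DecidableRel G.Adj]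
    (X : V → V → ℝ) : V → V → V → ℝ :=
  fun i j k => if G.Adj i j ∧ G.Adj j k ∧ G.Adj k i then X i j + X j k + X k i else 0

/-- The weighted divergence of an edge flow: `(div X)(i) = Σ_{j : {i,j} ∈ E} w i j * X i j`. -/
noncomputable def divW {V : Type*} [Fintype V] (G : SimpleGraph V) [DecidableRel G.Adj]
    (w X : V → V → ℝ) : V → ℝ :=
  fun i => ∑ j, if G.Adj i j then w i j * X i j else 0

/-- The weighted inner product of edge flows:
`⟨X,Y⟩_w = Σ_{{i,j} ∈ E} w i j * X i j * Y i j` (each unordered edge counted once). -/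
noncomputable def innerW {V : Type*} [Fintype V] (G : SimpleGraph V) [DecidableRel G.Adj]
    (w X Y : V → V → ℝ) : ℝ :=
  (1 / 2) * ∑ i, ∑ j, if G.Adj i j then w i j * X i j * Y i j else 0

/-- The weighted inner product of edge flows as a bilinear form on `V → V → ℝ`. -/
noncomputable def innerWForm {V : Type*} [Fintype V] (G : SimpleGraph V) [DecidableRel G.Adj]
    (w : V → V → ℝ) : LinearMap.BilinForm ℝ (V → V → ℝ) :=
  LinearMap.mk₂ ℝ (innerW G w)
    (fun X Y Z => by
      simp only [innerW, Pi.add_apply, mul_add, add_mul, ite_add_zero, Finset.sum_add_distrib])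
    (fun c X Y => by
      simp only [innerW, smul_eq_mul, Finset.mul_sum]
      refine Finset.sum_congr rfl fun i _ => Finset.sum_congr rfl fun j _ => ?_
      rw [Pi.smul_apply, Pi.smul_apply, smul_eq_mul]
      split_ifs <;> ring)
    (fun X Y Z => by
      simp only [innerW, Pi.add_apply, mul_add, ite_add_zero, Finset.sum_add_distrib])
    (fun c X Y => by
      simp only [innerW, smul_eq_mul, Finset.mul_sum]
      refine Finset.sum_congr rfl fun i _ => Finset.sum_congr rfl fun j _ => ?_
      rw [Pi.smul_apply, Pi.smul_apply, smul_eq_mul]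
      split_ifs <;> ring)

@[simp]
theorem innerWForm_apply {V : Type*} [Fintype V] (G : SimpleGraph V) [DecidableRel G.Adj]
    (w X Y : V → V → ℝ) : innerWForm G w X Y = innerW G w X Y := rfl

theorem innerW_comm {V : Type*} [Fintype V] (G : SimpleGraph V) [DecidableRel G.Adj]
    (w X Y : V → V → ℝ) : innerW G w X Y = innerW G w Y X := by
  simp only [innerW, mul_right_comm]

theorem innerWForm_isRefl {V : Type*} [Fintype V] (G : SimpleGraph V) [DecidableRel G.Adj]
    (w : V → V → ℝ) : (innerWForm G w).IsRefl := fun X Y h => by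
  rwa [innerWForm_apply, innerW_comm]

theorem IsEdgeFlow.eq_zero_of_innerW_self {V : Type*} [Fintype V] {G : SimpleGraph V}
    [DecidableRel G.Adj] {w X : V → V → ℝ} (hw : ∀ i j, G.Adj i j → 0 < w i j)
    (hX : IsEdgeFlow G X) (h : innerW G w X X = 0) : X = 0 := by
  have hnn : ∀ i j, 0 ≤ if G.Adj i j then w i j * X i j * X i j else 0 := fun i j => by
    split_ifs with hij
    · rw [mul_assoc]
      exact mul_nonneg (hw i j hij).le (mul_self_nonneg _)
    · exact le_rfl
  have h0 : ∑ i, ∑ j, (if G.Adj i j then w i j * X i j * X i j else 0) = 0 := by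
    simpa [innerW] using h
  funext i j
  by_cases hij : G.Adj i j
  · have hi := (Finset.sum_eq_zero_iff_of_nonneg
      (fun i _ => Finset.sum_nonneg fun j _ => hnn i j)).1 h0 i (Finset.mem_univ i)
    have hj := (Finset.sum_eq_zero_iff_of_nonneg (fun j _ => hnn i j)).1 hi j (Finset.mem_univ j)
    simpa [hij, (hw i j hij).ne'] using hj
  · exact hX.2 i j hij

/-- The subspace of curl-free edge flows. -/
def curlFreeFlows {V : Type*} (G : SimpleGraph V) [DecidableRel G.Adj] :
    Submodule ℝ (V → V → ℝ) where
  carrier := {X | IsEdgeFlow G X ∧ curlFlow G X = 0}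
  zero_mem' := ⟨⟨by simp, by simp⟩, by ext; simp [curlFlow]⟩
  add_mem' := by
    rintro X Y ⟨hX, hX0⟩ ⟨hY, hY0⟩
    refine ⟨⟨fun i j h => ?_, fun i j h => ?_⟩, ?_⟩
    · simp only [Pi.add_apply, hX.1 i j h, hY.1 i j h]
      ring
    · simp [hX.2 i j h, hY.2 i j h]
    · funext i j k
      have h1 := congrFun (congrFun (congrFun hX0 i) j) k
      have h2 := congrFun (congrFun (congrFun hY0 i) j) k
      simp only [curlFlow, Pi.zero_apply, Pi.add_apply] at h1 h2 ⊢
      split_ifs at h1 h2 ⊢ <;> linarith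
  smul_mem' := by
    rintro c X ⟨hX, hX0⟩
    refine ⟨⟨fun i j h => ?_, fun i j h => ?_⟩, ?_⟩
    · simp [hX.1 i j h]
    · simp [hX.2 i j h]
    · funext i j k
      have h1 := congrFun (congrFun (congrFun hX0 i) j) k
      simp only [curlFlow, Pi.zero_apply, Pi.smul_apply, smul_eq_mul, ← mul_add] at h1 ⊢
      split_ifs at h1 ⊢ <;> simp [*]

/-- The gradient as a linear map. -/
noncomputable def gradLin {V : Type*} (G : SimpleGraph V) [DecidableRel G.Adj] :
    (V → ℝ) →ₗ[ℝ] (V → V → ℝ) where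
  toFun := gradFlow G
  map_add' s t := by
    funext i j
    simp only [gradFlow, Pi.add_apply]
    split_ifs <;> ring
  map_smul' c s := by
    funext i j
    simp only [gradFlow, Pi.smul_apply, smul_eq_mul, RingHom.id_apply]
    split_ifs <;> ring

theorem gradFlow_mem_curlFreeFlows {V : Type*} (G : SimpleGraph V) [DecidableRel G.Adj]
    (s : V → ℝ) : gradFlow G s ∈ curlFreeFlows G := by
  refine ⟨⟨fun i j h => ?_, fun i j h => ?_⟩, ?_⟩
  · simp [gradFlow, h, h.symm]
  · simp [gradFlow, h]
  · funext i j k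
    simp only [curlFlow, gradFlow, Pi.zero_apply]
    split_ifs with h
    all_goals simp_all

theorem isCompl_orthogonal_of_le_curlFreeFlows {V : Type*} [Fintype V] {G : SimpleGraph V}
    [DecidableRel G.Adj] {w : V → V → ℝ} (hw : ∀ i j, G.Adj i j → 0 < w i j)
    {K : Submodule ℝ (V → V → ℝ)} (hK : K ≤ curlFreeFlows G) :
    IsCompl K ((innerWForm G w).orthogonal K) := by
  rw [LinearMap.BilinForm.isCompl_orthogonal_iff_disjoint (innerWForm_isRefl G w),
    Submodule.disjoint_def]
  exact fun X hX hX' => (hK hX).1.eq_zero_of_innerW_self hw (hX' X hX)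

/-- The gradient is the negative adjoint of the divergence. -/
theorem innerW_gradFlow {V : Type*} [Fintype V] {G : SimpleGraph V} [DecidableRel G.Adj]
    {w : V → V → ℝ} (hw : ∀ i j, w i j = w j i) {H : V → V → ℝ} (hH : IsEdgeFlow G H)
    (s : V → ℝ) : innerW G w (gradFlow G s) H = -∑ i, s i * divW G w H i := by
  have hswap : ∑ i, ∑ j, (if G.Adj i j then w i j * s j * H i j else 0) =
      -∑ i, ∑ j, (if G.Adj i j then w i j * s i * H i j else 0) := by
    rw [Finset.sum_comm]
    simp only [← Finset.sum_neg_distrib]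
    refine Finset.sum_congr rfl fun i _ => Finset.sum_congr rfl fun j _ => ?_
    by_cases h : G.Adj i j
    · rw [if_pos h, if_pos h.symm, hH.1 i j h, hw i j]
      ring
    · rw [if_neg h, if_neg fun h' => h h'.symm, neg_zero]
  have hdiv : ∑ i, s i * divW G w H i =
      ∑ i, ∑ j, (if G.Adj i j then w i j * s i * H i j else 0) := by
    simp only [divW, Finset.mul_sum]
    refine Finset.sum_congr rfl fun i _ => Finset.sum_congr rfl fun j _ => ?_
    split_ifs <;> ring
  have hsub : innerW G w (gradFlow G s) H =
      (1 / 2) * (∑ i, ∑ j, (if G.Adj i j then w i j * s j * H i j else 0) -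
        ∑ i, ∑ j, (if G.Adj i j then w i j * s i * H i j else 0)) := by
    simp only [innerW, gradFlow, ← Finset.sum_sub_distrib]
    refine congrArg _ (Finset.sum_congr rfl fun i _ => Finset.sum_congr rfl fun j _ => ?_)
    split_ifs <;> ring
  rw [hsub, hswap, hdiv]
  ring

theorem divW_eq_zero_iff {V : Type*} [Fintype V] {G : SimpleGraph V} [DecidableRel G.Adj]
    {w : V → V → ℝ} (hw : ∀ i j, w i j = w j i) {H : V → V → ℝ} (hH : IsEdgeFlow G H) :
    divW G w H = 0 ↔ ∀ s, innerW G w (gradFlow G s) H = 0 := by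
  classical
  refine ⟨fun h s => by simp [innerW_gradFlow hw hH, h], fun h => funext fun i => ?_⟩
  simpa [innerW_gradFlow hw hH, Pi.single_apply] using h (Pi.single i 1)

/-- Helmholtz decomposition: every edge flow decomposes uniquely as the orthogonal sum
of a gradient flow, a harmonic flow (curl-free and divergence-free), and a locally
cyclic flow (orthogonal to all curl-free flows). -/
theorem helmholtz_decomposition {V : Type*} [Fintype V] (G : SimpleGraph V)
    [DecidableRel G.Adj] (w : V → V → ℝ)
    (hw_symm : ∀ i j, w i j = w j i) (hw_pos : ∀ i j, G.Adj i j → 0 < w i j)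
    (X : V → V → ℝ) (hX : IsEdgeFlow G X) :
    ∃! p : (V → V → ℝ) × (V → V → ℝ) × (V → V → ℝ),
      (∃ s : V → ℝ, p.1 = gradFlow G s) ∧
      (IsEdgeFlow G p.2.1 ∧ curlFlow G p.2.1 = 0 ∧ divW G w p.2.1 = 0) ∧
      (IsEdgeFlow G p.2.2 ∧
        ∀ Z, IsEdgeFlow G Z → curlFlow G Z = 0 → innerW G w p.2.2 Z = 0) ∧
      (∀ i j, X i j = p.1 i j + p.2.1 i j + p.2.2 i j) ∧
      innerW G w p.1 p.2.1 = 0 ∧ innerW G w p.1 p.2.2 = 0 ∧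
      innerW G w p.2.1 p.2.2 = 0 := by
  obtain ⟨z, hz, c, hc, hzc⟩ := Submodule.mem_sup.1
    ((isCompl_orthogonal_of_le_curlFreeFlows hw_pos (le_refl (curlFreeFlows G))).sup_eq_top ▸
      Submodule.mem_top : X ∈ _)
  have hgrad : LinearMap.range (gradLin G) ≤ curlFreeFlows G := by
    rintro _ ⟨s, rfl⟩
    exact gradFlow_mem_curlFreeFlows G s
  obtain ⟨_, ⟨s, rfl⟩, h, hh, hgh⟩ := Submodule.mem_sup.1
    ((isCompl_orthogonal_of_le_curlFreeFlows hw_pos hgrad).sup_eq_top ▸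
      Submodule.mem_top : z ∈ _)
  change gradFlow G s + h = z at hgh
  have hg := gradFlow_mem_curlFreeFlows G s
  have hhK : h ∈ curlFreeFlows G := by
    rw [← add_sub_cancel_left (gradFlow G s) h, hgh]
    exact sub_mem hz hg
  have hc' : ∀ Z ∈ curlFreeFlows G, innerW G w Z c = 0 := hc
  have hcflow : IsEdgeFlow G c := by
    rw [← add_sub_cancel_left z c, hzc]
    refine ⟨fun i j hij => ?_, fun i j hij => ?_⟩
    · simp only [Pi.sub_apply, hX.1 i j hij, hz.1.1 i j hij]
      ring
    · simp [hX.2 i j hij, hz.1.2 i j hij]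
  refine ⟨(gradFlow G s, h, c), ⟨⟨s, rfl⟩, ⟨hhK.1, hhK.2, ?_⟩,
    ⟨hcflow, fun Z hZ hZ0 => ?_⟩, fun i j => ?_, hh _ ⟨s, rfl⟩, hc' _ hg, hc' _ hhK⟩, ?_⟩
  · exact (divW_eq_zero_iff hw_symm hhK.1).2 fun t => hh _ ⟨t, rfl⟩
  · rw [innerW_comm]
    exact hc' Z ⟨hZ, hZ0⟩
  · rw [← hzc, ← hgh]
    rfl
  rintro ⟨g', h', c'⟩ ⟨⟨s', rfl⟩, ⟨hh'1, hh'2, hh'3⟩, ⟨-, hc'2⟩, hsum, -⟩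
  have hg' := gradFlow_mem_curlFreeFlows G s'
  have hh'K : h' ∈ curlFreeFlows G := ⟨hh'1, hh'2⟩
  have hX' : X = gradFlow G s' + h' + c' := funext fun i => funext fun j => hsum i j
  have hcK : c' - c ∈ curlFreeFlows G := by
    have : c' - c = z - (gradFlow G s' + h') := by
      rw [sub_eq_sub_iff_add_eq_add, add_comm c', ← hX', hzc]
    rw [this]
    exact sub_mem hz (add_mem hg' hh'K)
  have hcc : c' - c = 0 := by
    refine hcK.1.eq_zero_of_innerW_self hw_pos ?_
    have h1 := hc' _ hcK
    have h2 := hc'2 _ hcK.1 hcK.2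
    rw [innerW_comm] at h2
    rw [← innerWForm_apply] at h1 h2 ⊢
    rw [map_sub, h1, h2, sub_zero]
  obtain rfl : c' = c := sub_eq_zero.1 hcc
  have hsum' : gradFlow G s' + h' = gradFlow G s + h := by
    rw [hgh]
    exact add_right_cancel (hX'.symm.trans hzc.symm)
  have hdiff : h' - h = gradLin G (s - s') := by
    rw [map_sub]
    change h' - h = gradFlow G s - gradFlow G s'
    rw [sub_eq_sub_iff_add_eq_add, add_comm h', hsum']
  have hhh : h' - h = 0 := by
    refine (sub_mem hh'K hhK).1.eq_zero_of_innerW_self hw_pos ?_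
    have h1 : innerWForm G w (gradLin G (s - s')) h = 0 := hh _ ⟨_, rfl⟩
    have h2 : innerWForm G w (gradLin G (s - s')) h' = 0 :=
      (divW_eq_zero_iff hw_symm hh'1).1 hh'3 _
    rw [← hdiff] at h1 h2
    rw [← innerWForm_apply, map_sub, h1, h2, sub_zero]
  obtain rfl : h' = h := sub_eq_zero.1 hhh
  rw [add_right_cancel hsum']
end

section
/- Let n ≥ 1, let G be the complete graph on V = {1,…,n} with unit weights w_{ij} = 1, and let Ȳ be a skew-symmetric function Ȳ : V×V → ℝ. Define s* : V → ℝ by s*_i = −(1/n) Σ_{j=1}^n Ȳ(i,j). Then s* minimizes F(s) = Σ_{i<j} (s_j − s_i − Ȳ(i,j))², satisfies Σ_{i=1}^n s*_i = 0, and has minimal Euclidean norm among all minimizers of F. (This minimum-norm least squares solution is, up to a positive multiplicative constant, the Borda count.) -/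
open Finset

/-- The least squares objective on the complete graph with unit weights:
`F(s) = Σ_{i<j} (s j - s i - Y i j)²`. -/
noncomputable def lsObjComplete {n : ℕ} (Y : Fin n → Fin n → ℝ) (s : Fin n → ℝ) : ℝ :=
  ∑ i, ∑ j, if i < j then (s j - s i - Y i j) ^ 2 else 0

/-- Summing a symmetric function with zero diagonal over all ordered pairs counts every
pair `i < j` twice. -/
theorem sum_sum_eq_two_mul_sum_lt {n : ℕ} (f : Fin n → Fin n → ℝ)
    (hsymm : ∀ i j, f i j = f j i) (hdiag : ∀ i, f i i = 0) :
    ∑ i, ∑ j, f i j = 2 * ∑ i, ∑ j, if i < j then f i j else 0 := by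
  have hsplit : ∀ i j, f i j = (if i < j then f i j else 0) + if j < i then f j i else 0 := by
    intro i j
    rcases lt_trichotomy i j with h | rfl | h
    · simp [h, h.not_gt]
    · simp [hdiag]
    · simp [h, h.not_gt, hsymm i j]
  calc ∑ i, ∑ j, f i j
      = ∑ i, ∑ j, ((if i < j then f i j else 0) + if j < i then f j i else 0) :=
        sum_congr rfl fun i _ => sum_congr rfl fun j _ => hsplit i j
    _ = (∑ i, ∑ j, if i < j then f i j else 0) + ∑ i, ∑ j, if j < i then f j i else 0 := by
        simp only [sum_add_distrib]
    _ = 2 * ∑ i, ∑ j, if i < j then f i j else 0 := by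
        rw [sum_comm (f := fun i j => if j < i then f j i else 0), two_mul]

theorem two_mul_lsObjComplete {n : ℕ} (Y : Fin n → Fin n → ℝ)
    (hskew : ∀ i j, Y i j = - Y j i) (s : Fin n → ℝ) :
    2 * lsObjComplete Y s = ∑ i, ∑ j, (s j - s i - Y i j) ^ 2 := by
  refine (sum_sum_eq_two_mul_sum_lt _ (fun i j => ?_) fun i => ?_).symm
  · rw [hskew i j]; ring
  · have : Y i i = 0 := by linarith [hskew i i]
    simp [this]

/-- A skew-symmetric function with zero row sums is orthogonal to every gradient flow. -/
theorem sum_mul_grad_eq_zero {n : ℕ} (R : Fin n → Fin n → ℝ)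
    (hskew : ∀ i j, R i j = - R j i) (hrow : ∀ i, ∑ j, R i j = 0) (d : Fin n → ℝ) :
    ∑ i, ∑ j, R i j * (d j - d i) = 0 := by
  have hcol : ∀ j, ∑ i, R i j = 0 := fun j => by
    simp only [fun i => hskew i j, sum_neg_distrib, hrow, neg_zero]
  simp only [mul_sub, sum_sub_distrib]
  rw [sum_comm]
  simp only [← sum_mul, hrow, hcol, zero_mul, sum_const_zero, sub_zero]

/-- Pythagoras for the least squares objective around a solution `s` of the normal equations. -/
theorem two_mul_lsObjComplete_eq_add {n : ℕ} (Y : Fin n → Fin n → ℝ)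
    (hskew : ∀ i j, Y i j = - Y j i) (s : Fin n → ℝ)
    (hnormal : ∀ i, ∑ j, (s j - s i - Y i j) = 0) (t : Fin n → ℝ) :
    2 * lsObjComplete Y t =
      2 * lsObjComplete Y s + ∑ i, ∑ j, ((t j - s j) - (t i - s i)) ^ 2 := by
  have hcross := sum_mul_grad_eq_zero (fun i j => s j - s i - Y i j)
    (fun i j => by rw [hskew i j]; ring) hnormal (fun i => t i - s i)
  have hexpand : ∀ i j, (t j - t i - Y i j) ^ 2 = (s j - s i - Y i j) ^ 2 +
      ((t j - s j) - (t i - s i)) ^ 2 +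
      2 * ((s j - s i - Y i j) * ((t j - s j) - (t i - s i))) := fun i j => by ring
  rw [two_mul_lsObjComplete Y hskew, two_mul_lsObjComplete Y hskew]
  simp only [hexpand, sum_add_distrib, ← mul_sum]
  rw [hcross]
  ring

theorem sum_sum_eq_zero_of_skew {n : ℕ} (Y : Fin n → Fin n → ℝ)
    (hskew : ∀ i j, Y i j = - Y j i) : ∑ i, ∑ j, Y i j = 0 := by
  have h : ∑ i, ∑ j, Y i j = - ∑ i, ∑ j, Y i j := by
    conv_lhs => rw [sum_comm]
    simp only [← sum_neg_distrib, ← hskew]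
  linarith

/-- On the complete graph with unit weights, `s*_i = −(1/n) Σ_j Y i j` minimizes the
least squares objective, has entries summing to zero, and is the minimum-norm
minimizer. (This is the Borda count, up to a positive multiplicative constant.) -/
theorem borda_count_min_norm_ls {n : ℕ} (hn : 1 ≤ n)
    (Y : Fin n → Fin n → ℝ) (hskew : ∀ i j, Y i j = - Y j i) :
    (∀ t : Fin n → ℝ,
        lsObjComplete Y (fun i => -(1 / (n : ℝ)) * ∑ j, Y i j) ≤ lsObjComplete Y t) ∧
    (∑ i, (-(1 / (n : ℝ)) * ∑ j, Y i j) = 0) ∧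
    (∀ t : Fin n → ℝ, (∀ u : Fin n → ℝ, lsObjComplete Y t ≤ lsObjComplete Y u) →
      ∑ i, (-(1 / (n : ℝ)) * ∑ j, Y i j) ^ 2 ≤ ∑ i, (t i) ^ 2) := by
  have hn0 : (n : ℝ) ≠ 0 := by positivity
  have hsum : ∑ i, (-(1 / (n : ℝ)) * ∑ j, Y i j) = 0 := by
    rw [← mul_sum, sum_sum_eq_zero_of_skew Y hskew, mul_zero]
  have hs : ∀ i, (n : ℝ) * (-(1 / (n : ℝ)) * ∑ j, Y i j) = - ∑ j, Y i j := fun i => by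
    field_simp
  set s : Fin n → ℝ := fun i => -(1 / (n : ℝ)) * ∑ j, Y i j
  change ∑ i, s i = 0 at hsum
  change ∀ i, (n : ℝ) * s i = - ∑ j, Y i j at hs
  have hnormal : ∀ i, ∑ j, (s j - s i - Y i j) = 0 := fun i => by
    simp [sum_sub_distrib, hsum, hs]
  have hpyth := two_mul_lsObjComplete_eq_add Y hskew s hnormal
  have hnonneg : ∀ t : Fin n → ℝ, ∀ i ∈ univ,
      0 ≤ ∑ j, ((t j - s j) - (t i - s i)) ^ 2 :=
    fun t i _ => sum_nonneg fun j _ => sq_nonneg _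
  refine ⟨fun t => by linarith [hpyth t, sum_nonneg (hnonneg t)], hsum, fun t ht => ?_⟩
  change ∑ i, s i ^ 2 ≤ ∑ i, t i ^ 2
  have hzero : ∑ i, ∑ j, ((t j - s j) - (t i - s i)) ^ 2 = 0 :=
    le_antisymm (by linarith [hpyth t, ht s]) (sum_nonneg (hnonneg t))
  let k : Fin n := ⟨0, hn⟩
  have hshift : ∀ i, t i = s i + (t k - s k) := fun i => by
    have hrow := (sum_eq_zero_iff_of_nonneg (hnonneg t)).1 hzero k (mem_univ k)
    have hsq := (sum_eq_zero_iff_of_nonneg fun j _ => sq_nonneg _).1 hrow i (mem_univ i)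
    linarith [pow_eq_zero_iff two_ne_zero |>.1 hsq]
  generalize t k - s k = c at hshift
  have hnorm : ∑ i, t i ^ 2 = ∑ i, s i ^ 2 + n * c ^ 2 := by
    simp only [hshift, add_sq, sum_add_distrib, ← sum_mul, ← mul_sum, hsum]
    simp
  rw [hnorm]
  exact le_add_of_nonneg_right (by positivity)
end

section
/- Let V = {1,…,n}, let w_{ij} = w_{ji} > 0 for all i ≠ j (so the comparison graph is complete with positive weights), and let Ȳ : V×V → ℝ be skew-symmetric. Then strong LP duality holds between the l1-projection onto gradient flows and correlation maximization over bounded divergence-free flows: min over s : V → ℝ of Σ_{i<j} w_{ij} |s_j − s_i − Ȳ(i,j)| equals max over skew-symmetric X : V×V → ℝ satisfying |X(i,j)| ≤ 1 for all i,j and (div X)(i) = Σ_j w_{ij} X(i,j) = 0 for all i, of ⟨X, Ȳ⟩_w = Σ_{i<j} w_{ij} X(i,j) Ȳ(i,j); and both the minimum and the maximum are attained. -/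
open Finset

/-- The weighted `l¹` objective of the projection onto gradient flows:
`‖grad s − Y‖_{1,w} = Σ_{i<j} w i j * |s j − s i − Y i j|`. -/
noncomputable def primalL1Obj {n : ℕ} (w Y : Fin n → Fin n → ℝ) (s : Fin n → ℝ) : ℝ :=
  ∑ i, ∑ j, if i < j then w i j * |s j - s i - Y i j| else 0

/-- The correlation objective `⟨X, Y⟩_w = Σ_{i<j} w i j * X i j * Y i j`. -/
noncomputable def dualCorrObj {n : ℕ} (w Y X : Fin n → Fin n → ℝ) : ℝ :=
  ∑ i, ∑ j, if i < j then w i j * X i j * Y i j else 0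

/-- Summation by parts: the gradient is minus the adjoint of the divergence. -/
theorem sum_lt_mul_grad_eq_neg_sum_mul_div {n : ℕ} {w X : Fin n → Fin n → ℝ}
    (hw : ∀ i j, w i j = w j i) (hX : ∀ i j, X i j = - X j i) (s : Fin n → ℝ) :
    ∑ i, ∑ j, (if i < j then w i j * X i j * (s j - s i) else 0) =
      - ∑ i, s i * ∑ j, w i j * X i j := by
  have hsplit : ∑ i, ∑ j, (if i < j then w i j * X i j * (s j - s i) else 0) =
      ∑ i, ∑ j, (if i < j then w i j * X i j * s j else 0) -
        ∑ i, ∑ j, (if i < j then w i j * X i j * s i else 0) := by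
    simp only [← Finset.sum_sub_distrib]
    refine Finset.sum_congr rfl fun i _ => Finset.sum_congr rfl fun j _ => ?_
    split_ifs <;> ring
  rw [hsplit, Finset.sum_comm, ← Finset.sum_sub_distrib, ← Finset.sum_neg_distrib]
  refine Finset.sum_congr rfl fun i _ => ?_
  rw [← Finset.sum_sub_distrib, Finset.mul_sum, ← Finset.sum_neg_distrib]
  refine Finset.sum_congr rfl fun j _ => ?_
  rcases lt_trichotomy i j with h | rfl | h
  · simp only [h, h.not_gt, if_true, if_false]; ring
  · have : X i i = 0 := by linarith [hX i i]
    simp [this]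
  · simp only [h, h.not_gt, if_true, if_false]
    rw [hw j i, hX j i]; ring

/-- Weak duality: a bounded divergence-free flow correlates with `Y` by at most the `l¹`-distance
from `Y` to any gradient flow. -/
theorem dualCorrObj_le_primalL1Obj {n : ℕ} {w X : Fin n → Fin n → ℝ}
    (hw_symm : ∀ i j, w i j = w j i) (hw_pos : ∀ i j, i ≠ j → 0 < w i j)
    (hX : ∀ i j, X i j = - X j i) (hX_le : ∀ i j, |X i j| ≤ 1)
    (hX_div : ∀ i, ∑ j, w i j * X i j = 0) (Y : Fin n → Fin n → ℝ) (s : Fin n → ℝ) :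
    dualCorrObj w Y X ≤ primalL1Obj w Y s := by
  have hgrad := sum_lt_mul_grad_eq_neg_sum_mul_div hw_symm hX s
  simp only [hX_div, mul_zero, Finset.sum_const_zero, neg_zero] at hgrad
  rw [← sub_zero (dualCorrObj w Y X), ← hgrad, dualCorrObj, primalL1Obj]
  simp only [← Finset.sum_sub_distrib]
  refine Finset.sum_le_sum fun i _ => Finset.sum_le_sum fun j _ => ?_
  split_ifs with h
  · have hle : X i j * (Y i j - (s j - s i)) ≤ |s j - s i - Y i j| := by
      refine (le_abs_self _).trans ?_
      rw [abs_mul, abs_sub_comm (Y i j)]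
      exact mul_le_of_le_one_left (abs_nonneg _) (hX_le i j)
    have := mul_le_mul_of_nonneg_left hle (hw_pos i j h.ne).le
    linarith
  · simp

/-- In a finite-dimensional normed space, the distance to a subspace is attained, and it is the
value of a functional of norm at most one that vanishes on the subspace. -/
theorem Submodule.exists_dual_eq_norm_sub {E : Type*} [NormedAddCommGroup E] [NormedSpace ℝ E]
    [FiniteDimensional ℝ E] (M : Submodule ℝ E) (y : E) :
    ∃ m ∈ M, ∃ f : E →L[ℝ] ℝ, ‖f‖ ≤ 1 ∧ (∀ x ∈ M, f x = 0) ∧ f y = ‖m - y‖ := by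
  have : ProperSpace E := FiniteDimensional.proper ℝ E
  have : IsClosed (M : Set E) := M.closed_of_finiteDimensional
  obtain ⟨m, hm, hdist⟩ := this.exists_infDist_eq_dist ⟨0, M.zero_mem⟩ y
  obtain ⟨g, hg, hgy⟩ := exists_dual_vector'' ℝ (M.mkQ y)
  refine ⟨m, hm, g.comp M.mkQL, ?_, fun x hx => ?_, ?_⟩
  · refine ContinuousLinearMap.opNorm_le_bound _ zero_le_one fun x => ?_
    exact (g.le_of_opNorm_le hg _).trans
      (mul_le_mul_of_nonneg_left (Submodule.Quotient.norm_mk_le M x) zero_le_one)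
  · have : M.mkQ x = 0 := (Submodule.Quotient.mk_eq_zero M).2 hx
    change g (M.mkQ x) = 0
    rw [this, map_zero]
  · change g (M.mkQ y) = _
    rw [hgy, ← dist_eq_norm, dist_comm, ← hdist]
    exact QuotientAddGroup.norm_mk y

/-- A function on ordered pairs, restricted to the pairs `i < j`, as a vector of `ℓ¹`. -/
def upperPart (n : ℕ) : (Fin n → Fin n → ℝ) →ₗ[ℝ] PiLp 1 (fun _ : Fin n × Fin n => ℝ) where
  toFun Z := WithLp.toLp 1 fun e => if e.1 < e.2 then Z e.1 e.2 else 0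
  map_add' Z Z' := by
    ext e
    by_cases h : e.1 < e.2 <;> simp [h]
  map_smul' c Z := by
    ext e
    by_cases h : e.1 < e.2 <;> simp [h]

/-- The weighted gradient `s ↦ (w i j * (s j - s i))`. -/
def weightedGrad {n : ℕ} (w : Fin n → Fin n → ℝ) : (Fin n → ℝ) →ₗ[ℝ] (Fin n → Fin n → ℝ) where
  toFun s i j := w i j * (s j - s i)
  map_add' s t := by
    ext i j
    simp only [Pi.add_apply]
    ring
  map_smul' c s := by
    ext i j
    simp only [Pi.smul_apply, smul_eq_mul, RingHom.id_apply]
    ring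

theorem norm_upperPart {n : ℕ} (Z : Fin n → Fin n → ℝ) :
    ‖upperPart n Z‖ = ∑ i, ∑ j, if i < j then |Z i j| else 0 := by
  rw [PiLp.norm_eq_of_L1, Fintype.sum_prod_type]
  refine Finset.sum_congr rfl fun i _ => Finset.sum_congr rfl fun j _ => ?_
  by_cases h : i < j <;> simp [upperPart, h]

theorem apply_upperPart {n : ℕ} (f : PiLp 1 (fun _ : Fin n × Fin n => ℝ) →L[ℝ] ℝ)
    (Z : Fin n → Fin n → ℝ) :
    f (upperPart n Z) =
      ∑ i, ∑ j, if i < j then Z i j * f (PiLp.single 1 (i, j) 1) else 0 := by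
  have hsum : upperPart n Z =
      ∑ e : Fin n × Fin n, (upperPart n Z) e • PiLp.single 1 e (1 : ℝ) := by
    ext e
    simp [Pi.single_apply]
  rw [hsum, map_sum, Fintype.sum_prod_type]
  refine Finset.sum_congr rfl fun i _ => Finset.sum_congr rfl fun j _ => ?_
  by_cases h : i < j <;> simp [upperPart, h]

/-- The skew-symmetric function with prescribed values on the pairs `i < j`. -/
def skewExtend {n : ℕ} (c : Fin n → Fin n → ℝ) (i j : Fin n) : ℝ :=
  if i < j then c i j else if j < i then - c j i else 0

theorem skewExtend_skew {n : ℕ} (c : Fin n → Fin n → ℝ) (i j : Fin n) :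
    skewExtend c i j = - skewExtend c j i := by
  rcases lt_trichotomy i j with h | rfl | h <;> simp [skewExtend, *, lt_asymm]

theorem abs_skewExtend_le {n : ℕ} {c : Fin n → Fin n → ℝ} {b : ℝ} (hb : 0 ≤ b)
    (hc : ∀ i j, |c i j| ≤ b) (i j : Fin n) : |skewExtend c i j| ≤ b := by
  unfold skewExtend
  split_ifs <;> simp [hc, hb]

/-- Strong LP duality for the `l¹`-projection onto gradient flows: the minimum of
`‖grad s − Y‖_{1,w}` over potentials `s` equals the maximum of `⟨X, Y⟩_w` over
skew-symmetric `X` with `|X i j| ≤ 1` and `div X = 0`, and both are attained. -/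
theorem l1_projection_strong_duality {n : ℕ} (w : Fin n → Fin n → ℝ)
    (hw_symm : ∀ i j, w i j = w j i) (hw_pos : ∀ i j, i ≠ j → 0 < w i j)
    (Y : Fin n → Fin n → ℝ) (hY : ∀ i j, Y i j = - Y j i) :
    ∃ s₀ : Fin n → ℝ, ∃ X₀ : Fin n → Fin n → ℝ,
      (∀ i j, X₀ i j = - X₀ j i) ∧ (∀ i j, |X₀ i j| ≤ 1) ∧
      (∀ i, ∑ j, w i j * X₀ i j = 0) ∧
      (∀ s : Fin n → ℝ, primalL1Obj w Y s₀ ≤ primalL1Obj w Y s) ∧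
      (∀ X : Fin n → Fin n → ℝ, (∀ i j, X i j = - X j i) → (∀ i j, |X i j| ≤ 1) →
        (∀ i, ∑ j, w i j * X i j = 0) → dualCorrObj w Y X ≤ dualCorrObj w Y X₀) ∧
      primalL1Obj w Y s₀ = dualCorrObj w Y X₀ := by
  obtain ⟨m, ⟨s₀, rfl⟩, f, hf, hfM, hfy⟩ :=
    (LinearMap.range (upperPart n ∘ₗ weightedGrad w)).exists_dual_eq_norm_sub
      (upperPart n fun i j => w i j * Y i j)
  set c : Fin n → Fin n → ℝ := fun i j => f (PiLp.single 1 (i, j) 1) with hc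
  have hc_le : ∀ i j, |c i j| ≤ 1 := fun i j => by
    simpa using f.le_of_opNorm_le hf (PiLp.single 1 (i, j) 1)
  have hX := skewExtend_skew c
  have hX_le := abs_skewExtend_le zero_le_one hc_le
  have hX_div : ∀ i, ∑ j, w i j * skewExtend c i j = 0 := fun k => by
    have hzero := hfM _ ⟨Pi.single k 1, rfl⟩
    have hgrad := sum_lt_mul_grad_eq_neg_sum_mul_div hw_symm hX (Pi.single k 1)
    have heq : f (upperPart n (weightedGrad w (Pi.single k 1))) = _ := apply_upperPart f _
    rw [LinearMap.comp_apply, heq] at hzero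
    have hsame : ∑ i, ∑ j, (if i < j then w i j * skewExtend c i j *
        ((Pi.single k 1 : Fin n → ℝ) j - (Pi.single k 1 : Fin n → ℝ) i) else 0) = 0 := by
      refine Eq.trans ?_ hzero
      refine Finset.sum_congr rfl fun i _ => Finset.sum_congr rfl fun j _ => ?_
      split_ifs with h
      · simp only [skewExtend, h, if_true, weightedGrad, LinearMap.coe_mk, AddHom.coe_mk, hc]
        ring
      · rfl
    rw [hsame] at hgrad
    simpa [Pi.single_apply] using hgrad.symm
  have hval : primalL1Obj w Y s₀ = dualCorrObj w Y (skewExtend c) := by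
    rw [apply_upperPart, LinearMap.comp_apply, ← map_sub, norm_upperPart] at hfy
    rw [primalL1Obj, dualCorrObj]
    refine Eq.trans ?_ (hfy.symm.trans ?_)
    · refine Finset.sum_congr rfl fun i _ => Finset.sum_congr rfl fun j _ => ?_
      split_ifs with h
      · simp only [weightedGrad, LinearMap.coe_mk, AddHom.coe_mk, Pi.sub_apply, ← mul_sub]
        rw [abs_mul, abs_of_pos (hw_pos i j h.ne)]
      · rfl
    · refine Finset.sum_congr rfl fun i _ => Finset.sum_congr rfl fun j _ => ?_
      split_ifs with h
      · simp only [skewExtend, h, if_true, hc]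
        ring
      · rfl
  refine ⟨s₀, skewExtend c, hX, hX_le, hX_div, fun s => ?_, fun X hX' hX'_le hX'_div => ?_, hval⟩
  · rw [hval]
    exact dualCorrObj_le_primalL1Obj hw_symm hw_pos hX hX_le hX_div Y s
  · rw [← hval]
    exact dualCorrObj_le_primalL1Obj hw_symm hw_pos hX' hX'_le hX'_div Y s₀
end

section
/- Let G=(V,E) be a finite undirected simple graph with positive symmetric edge weights w, T(E) its set of triangles, and R an edge flow on G. For a triangular flow Φ (an alternating function on triples supported on T(E)), define the edge flow curl*Φ by (curl*Φ)(i,j) = w_{ij}^{-1} Σ_{k : {i,j,k}∈T(E)} Φ(i,j,k) for {i,j} ∈ E and 0 otherwise. Then strong LP duality holds: min over triangular flows Φ of Σ_{{i,j}∈E} |(curl*Φ)(i,j) − R(i,j)| equals max over edge flows X satisfying |X(i,j)| ≤ w_{ij}^{-1} for all {i,j} ∈ E and (curl X)(i,j,k) = 0 for all {i,j,k} ∈ T(E), of ⟨X, R⟩_w = Σ_{{i,j}∈E} w_{ij} X(i,j) R(i,j); and both the minimum and the maximum are attained. -/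
open Finset

/-- `Φ` is a triangular flow on `G`: alternating in its three arguments and zero on
triples that are not triangles of `G`. -/
def IsTriFlow {V : Type*} (G : SimpleGraph V) (Φ : V → V → V → ℝ) : Prop :=
  (∀ i j k, Φ i j k = Φ j k i) ∧ (∀ i j k, Φ i j k = - Φ j i k) ∧
    ∀ i j k, ¬ (G.Adj i j ∧ G.Adj j k ∧ G.Adj k i) → Φ i j k = 0

/-- The adjoint curl: `(curl* Φ)(i,j) = w i j⁻¹ * Σ_{k : {i,j,k} ∈ T(E)} Φ i j k` on
edges and `0` otherwise. -/
noncomputable def curlStar {V : Type*} [Fintype V] (G : SimpleGraph V)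
    [DecidableRel G.Adj] (w : V → V → ℝ) (Φ : V → V → V → ℝ) : V → V → ℝ :=
  fun i j => if G.Adj i j then
    (w i j)⁻¹ * ∑ k, if G.Adj i j ∧ G.Adj j k ∧ G.Adj k i then Φ i j k else 0
  else 0

/-- The unweighted `l¹` objective `Σ_{{i,j} ∈ E} |(curl* Φ)(i,j) − R(i,j)|`
(each unordered edge counted once). -/
noncomputable def sparseL1Obj {V : Type*} [Fintype V] (G : SimpleGraph V)
    [DecidableRel G.Adj] (w R : V → V → ℝ) (Φ : V → V → V → ℝ) : ℝ :=
  (1 / 2) * ∑ i, ∑ j, if G.Adj i j then |curlStar G w Φ i j - R i j| else 0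

/-- Duality for the distance to a subspace in `ℓ¹`: the distance is attained, and it is the value
at `r` of a functional of norm at most one that annihilates the subspace. -/
theorem exists_l1_dual_certificate {ι : Type*} [Fintype ι] (S : Submodule ℝ (ι → ℝ))
    (r : ι → ℝ) :
    ∃ s ∈ S, ∃ c : ι → ℝ, (∀ i, |c i| ≤ 1) ∧ (∀ t ∈ S, ∑ i, c i * t i = 0) ∧
      ∑ i, c i * r i = ∑ i, |s i - r i| := by
  classical
  let e := WithLp.linearEquiv 1 ℝ (ι → ℝ)
  let S' : Submodule ℝ (PiLp 1 fun _ : ι => ℝ) := S.comap e.toLinearMap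
  obtain ⟨s, hs, hdist⟩ := S'.closed_of_finiteDimensional.exists_infDist_eq_dist
    ⟨0, S'.zero_mem⟩ (WithLp.toLp 1 r)
  obtain ⟨g, hg, hgr⟩ := exists_dual_vector'' ℝ (S'.mkQ (WithLp.toLp 1 r))
  have hnorm : ‖S'.mkQ (WithLp.toLp 1 r)‖ = Metric.infDist (WithLp.toLp 1 r) (S' : Set _) :=
    QuotientAddGroup.norm_mk (S := S'.toAddSubgroup) _
  have hsum (x : ι → ℝ) :
      ∑ i, g (S'.mkQ (PiLp.single 1 i 1)) * x i = g (S'.mkQ (WithLp.toLp 1 x)) := by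
    have hx : WithLp.toLp 1 x = ∑ i, x i • PiLp.single (β := fun _ : ι => ℝ) 1 i 1 := by
      ext j
      simp [Pi.single_apply]
    simp only [hx, map_sum, map_smul, smul_eq_mul, mul_comm]
  refine ⟨s.ofLp, hs, fun i => g (S'.mkQ (PiLp.single 1 i 1)), fun i => ?_, fun t ht => ?_, ?_⟩
  · calc
      |g (S'.mkQ (PiLp.single 1 i 1))| ≤ 1 * ‖S'.mkQ (PiLp.single 1 i 1)‖ :=
        g.le_of_opNorm_le hg _
      _ ≤ 1 * ‖PiLp.single (β := fun _ : ι => ℝ) 1 i 1‖ := by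
        gcongr
        exact Submodule.Quotient.norm_mk_le _ _
      _ = 1 := by simp
  · have h : S'.mkQ (WithLp.toLp 1 t) = 0 := by
      rw [Submodule.mkQ_apply, Submodule.Quotient.mk_eq_zero]
      exact ht
    rw [hsum, h, map_zero]
  · rw [hsum, hgr]
    change ‖S'.mkQ (WithLp.toLp 1 r)‖ = _
    rw [hnorm, hdist, dist_comm, dist_eq_norm, PiLp.norm_eq_of_L1]
    simp

theorem IsEdgeFlow.curlFlow {V : Type*} {G : SimpleGraph V} [DecidableRel G.Adj]
    {X : V → V → ℝ} (hX : IsEdgeFlow G X) : IsTriFlow G (curlFlow G X) := by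
  refine ⟨fun i j k => ?_, fun i j k => ?_, fun i j k h => ?_⟩
  · have hiff : (G.Adj i j ∧ G.Adj j k ∧ G.Adj k i) ↔
        (G.Adj j k ∧ G.Adj k i ∧ G.Adj i j) := by tauto
    simp only [_root_.curlFlow, hiff]
    split_ifs <;> ring
  · have hiff : (G.Adj j i ∧ G.Adj i k ∧ G.Adj k j) ↔
        (G.Adj i j ∧ G.Adj j k ∧ G.Adj k i) := by
      rw [G.adj_comm j i, G.adj_comm i k, G.adj_comm k j]
      tauto
    simp only [_root_.curlFlow, hiff]
    split_ifs with h
    · rw [hX.1 i j h.1, hX.1 j k h.2.1, hX.1 k i h.2.2]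
      ring
    · simp
  · exact if_neg h

/-- The curl and `curlStar` are adjoint; each triangle is counted six times on the right. -/
theorem innerW_curlStar {V : Type*} [Fintype V] {G : SimpleGraph V} [DecidableRel G.Adj]
    {w : V → V → ℝ} (hw_pos : ∀ i j, G.Adj i j → 0 < w i j) (X : V → V → ℝ)
    {Φ : V → V → V → ℝ} (hΦ : IsTriFlow G Φ) :
    innerW G w X (curlStar G w Φ) = 1 / 6 * ∑ i, ∑ j, ∑ k, curlFlow G X i j k * Φ i j k := by
  have hinner : innerW G w X (curlStar G w Φ) = 1 / 2 * ∑ i, ∑ j, ∑ k, X i j * Φ i j k := by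
    unfold innerW curlStar
    congr 1
    refine sum_congr rfl fun i _ => sum_congr rfl fun j _ => ?_
    have hsum : (∑ k, if G.Adj i j ∧ G.Adj j k ∧ G.Adj k i then Φ i j k else 0) =
        ∑ k, Φ i j k := by
      refine sum_congr rfl fun k _ => ?_
      split_ifs with h
      · rfl
      · exact (hΦ.2.2 i j k h).symm
    rw [hsum, ← mul_sum]
    split_ifs with h
    · have := (hw_pos i j h).ne'
      field_simp
    · rw [sum_eq_zero fun k _ => hΦ.2.2 i j k fun h' => h h'.1, mul_zero]
  have hcurl (i j k : V) : curlFlow G X i j k * Φ i j k =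
      X i j * Φ i j k + X j k * Φ j k i + X k i * Φ k i j := by
    rw [← hΦ.1 i j k, hΦ.1 k i j]
    by_cases h : G.Adj i j ∧ G.Adj j k ∧ G.Adj k i
    · simp only [curlFlow, if_pos h]
      ring
    · simp [hΦ.2.2 i j k h]
  have hrot (f : V → V → V → ℝ) : ∑ i, ∑ j, ∑ k, f j k i = ∑ i, ∑ j, ∑ k, f i j k := by
    rw [sum_comm]
    exact sum_congr rfl fun j _ => sum_comm
  have h₁ := hrot fun i j k => X i j * Φ i j k
  have h₂ := hrot fun i j k => X j k * Φ j k i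
  rw [hinner]
  simp only [hcurl, sum_add_distrib]
  linarith

theorem curlFlow_eq_zero_of_innerW_curlStar {V : Type*} [Fintype V] {G : SimpleGraph V}
    [DecidableRel G.Adj] {w : V → V → ℝ} (hw_pos : ∀ i j, G.Adj i j → 0 < w i j)
    {X : V → V → ℝ} (hX : IsEdgeFlow G X)
    (h : innerW G w X (curlStar G w (curlFlow G X)) = 0) : curlFlow G X = 0 := by
  rw [innerW_curlStar hw_pos X hX.curlFlow] at h
  have h₀ : ∑ i, ∑ j, ∑ k, curlFlow G X i j k * curlFlow G X i j k = 0 := by linarith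
  have hnonneg (i j k : V) : 0 ≤ curlFlow G X i j k * curlFlow G X i j k := mul_self_nonneg _
  funext i j k
  have hi := (sum_eq_zero_iff_of_nonneg fun i _ => sum_nonneg fun j _ => sum_nonneg
    fun k _ => hnonneg i j k).1 h₀ i (mem_univ i)
  have hj := (sum_eq_zero_iff_of_nonneg fun j _ => sum_nonneg
    fun k _ => hnonneg i j k).1 hi j (mem_univ j)
  exact mul_self_eq_zero.1
    ((sum_eq_zero_iff_of_nonneg fun k _ => hnonneg i j k).1 hj k (mem_univ k))

theorem innerW_le_sparseL1Obj {V : Type*} [Fintype V] {G : SimpleGraph V} [DecidableRel G.Adj]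
    {w : V → V → ℝ} (hw_pos : ∀ i j, G.Adj i j → 0 < w i j) (R : V → V → ℝ)
    {Φ : V → V → V → ℝ} (hΦ : IsTriFlow G Φ) {X : V → V → ℝ}
    (hX : ∀ i j, G.Adj i j → |X i j| ≤ (w i j)⁻¹) (hcurl : curlFlow G X = 0) :
    innerW G w X R ≤ sparseL1Obj G w R Φ := by
  have h := innerW_curlStar hw_pos X hΦ
  simp only [hcurl, Pi.zero_apply, zero_mul, sum_const_zero, mul_zero] at h
  suffices innerW G w X R - innerW G w X (curlStar G w Φ) ≤ sparseL1Obj G w R Φ by linarith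
  simp only [innerW, sparseL1Obj, ← mul_sub, ← sum_sub_distrib]
  gcongr with i _ j _
  split_ifs with hij
  · have hw := hw_pos i j hij
    have hwX : |w i j * X i j| ≤ 1 := by
      rw [abs_mul, abs_of_pos hw]
      calc
        w i j * |X i j| ≤ w i j * (w i j)⁻¹ := by gcongr; exact hX i j hij
        _ = 1 := mul_inv_cancel₀ hw.ne'
    calc
      w i j * X i j * R i j - w i j * X i j * curlStar G w Φ i j
          = -(w i j * X i j * (curlStar G w Φ i j - R i j)) := by ring
      _ ≤ |w i j * X i j * (curlStar G w Φ i j - R i j)| := neg_le_abs _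
      _ = |w i j * X i j| * |curlStar G w Φ i j - R i j| := abs_mul _ _
      _ ≤ 1 * |curlStar G w Φ i j - R i j| := by gcongr
      _ = |curlStar G w Φ i j - R i j| := one_mul _
  · simp

theorem IsTriFlow.add {V : Type*} {G : SimpleGraph V} {Φ Ψ : V → V → V → ℝ}
    (hΦ : IsTriFlow G Φ) (hΨ : IsTriFlow G Ψ) : IsTriFlow G (Φ + Ψ) := by
  refine ⟨fun i j k => ?_, fun i j k => ?_, fun i j k h => ?_⟩
  · simp [hΦ.1 i j k, hΨ.1 i j k]
  · simp only [Pi.add_apply, hΦ.2.1 i j k, hΨ.2.1 i j k]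
    ring
  · simp [hΦ.2.2 i j k h, hΨ.2.2 i j k h]

theorem IsTriFlow.smul {V : Type*} {G : SimpleGraph V} {Φ : V → V → V → ℝ}
    (hΦ : IsTriFlow G Φ) (a : ℝ) : IsTriFlow G (a • Φ) := by
  refine ⟨fun i j k => ?_, fun i j k => ?_, fun i j k h => ?_⟩
  · simp [hΦ.1 i j k]
  · simp [hΦ.2.1 i j k]
  · simp [hΦ.2.2 i j k h]

theorem IsTriFlow.curlStar {V : Type*} [Fintype V] {G : SimpleGraph V} [DecidableRel G.Adj]
    {w : V → V → ℝ} (hw_symm : ∀ i j, w i j = w j i) {Φ : V → V → V → ℝ}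
    (hΦ : IsTriFlow G Φ) : IsEdgeFlow G (curlStar G w Φ) := by
  refine ⟨fun i j h => ?_, fun i j h => if_neg h⟩
  simp only [_root_.curlStar, if_pos h, if_pos h.symm]
  rw [hw_symm j i, ← mul_neg, ← sum_neg_distrib]
  congr 1
  refine sum_congr rfl fun k _ => ?_
  have hiff : (G.Adj j i ∧ G.Adj i k ∧ G.Adj k j) ↔
      (G.Adj i j ∧ G.Adj j k ∧ G.Adj k i) := by
    rw [G.adj_comm j i, G.adj_comm i k, G.adj_comm k j]
    tauto
  simp only [hiff]
  split_ifs
  · exact hΦ.2.1 i j k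
  · simp

/-- The linear subspace of `V × V → ℝ` formed by the flows `curlStar G w Φ`. -/
def curlStarSubmodule {V : Type*} [Fintype V] (G : SimpleGraph V) [DecidableRel G.Adj]
    (w : V → V → ℝ) : Submodule ℝ (V × V → ℝ) where
  carrier := {t | ∃ Φ, IsTriFlow G Φ ∧ ∀ p, t p = curlStar G w Φ p.1 p.2}
  zero_mem' := ⟨0, ⟨by simp, by simp, by simp⟩, by simp [curlStar]⟩
  add_mem' := by
    rintro s t ⟨Φ, hΦ, hs⟩ ⟨Ψ, hΨ, ht⟩
    refine ⟨Φ + Ψ, hΦ.add hΨ, fun p => ?_⟩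
    simp only [Pi.add_apply, hs, ht, curlStar]
    split_ifs
    · rw [← mul_add, ← sum_add_distrib]
      congr 1
      refine sum_congr rfl fun k _ => ?_
      split_ifs <;> simp
    · simp
  smul_mem' := by
    rintro a t ⟨Φ, hΦ, ht⟩
    refine ⟨a • Φ, hΦ.smul a, fun p => ?_⟩
    simp only [Pi.smul_apply, ht, curlStar, smul_eq_mul]
    split_ifs
    · rw [mul_left_comm, mul_sum]
      simp only [mul_ite, mul_zero]
    · simp

/-- The edge flow representing, with respect to `innerW`, half of the linear functional with
coefficients `c`. -/
noncomputable def rieszFlow {V : Type*} (G : SimpleGraph V) [DecidableRel G.Adj]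
    (w c : V → V → ℝ) : V → V → ℝ :=
  fun i j => if G.Adj i j then (w i j)⁻¹ * ((c i j - c j i) / 2) else 0

theorem isEdgeFlow_rieszFlow {V : Type*} {G : SimpleGraph V} [DecidableRel G.Adj]
    {w : V → V → ℝ} (hw_symm : ∀ i j, w i j = w j i) (c : V → V → ℝ) :
    IsEdgeFlow G (rieszFlow G w c) := by
  refine ⟨fun i j h => ?_, fun i j h => if_neg h⟩
  simp only [rieszFlow, if_pos h, if_pos h.symm, hw_symm j i]
  ring

theorem abs_rieszFlow_le {V : Type*} {G : SimpleGraph V} [DecidableRel G.Adj]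
    {w c : V → V → ℝ} (hc : ∀ i j, |c i j| ≤ 1) {i j : V} (h : G.Adj i j)
    (hw : 0 < w i j) : |rieszFlow G w c i j| ≤ (w i j)⁻¹ := by
  have hinv : 0 < (w i j)⁻¹ := inv_pos.2 hw
  have hcij : |(c i j - c j i) / 2| ≤ 1 := by
    have h₁ := abs_le.1 (hc i j)
    have h₂ := abs_le.1 (hc j i)
    exact abs_le.2 ⟨by linarith, by linarith⟩
  rw [rieszFlow, if_pos h, abs_mul, abs_of_pos hinv]
  exact mul_le_of_le_one_right hinv.le hcij

theorem innerW_rieszFlow {V : Type*} [Fintype V] {G : SimpleGraph V} [DecidableRel G.Adj]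
    {w : V → V → ℝ} (hw_pos : ∀ i j, G.Adj i j → 0 < w i j) (c : V → V → ℝ)
    {Y : V → V → ℝ} (hY : IsEdgeFlow G Y) :
    innerW G w (rieszFlow G w c) Y = 1 / 2 * ∑ i, ∑ j, c i j * Y i j := by
  have hterm (i j : V) : (if G.Adj i j then w i j * rieszFlow G w c i j * Y i j else 0) =
      1 / 2 * (c i j * Y i j) + 1 / 2 * (c j i * Y j i) := by
    split_ifs with h
    · have := (hw_pos i j h).ne'
      rw [hY.1 j i h.symm, rieszFlow, if_pos h]
      field_simp
      ring
    · simp [hY.2 i j h, hY.2 j i fun h' => h h'.symm]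
  have hswap : ∑ i, ∑ j, c j i * Y j i = ∑ i, ∑ j, c i j * Y i j := sum_comm
  simp only [innerW, hterm, sum_add_distrib, ← mul_sum]
  rw [hswap]
  ring

/-- Strong LP duality for the `l¹`-approximate sparse cyclic ranking problem: the
minimum over triangular flows `Φ` of `Σ_{{i,j} ∈ E} |(curl* Φ)(i,j) − R(i,j)|` equals
the maximum of `⟨X, R⟩_w` over edge flows `X` with `|X i j| ≤ w i j⁻¹` on edges and
`curl X = 0`, and both are attained. -/
theorem sparse_cyclic_strong_duality {V : Type*} [Fintype V] (G : SimpleGraph V)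
    [DecidableRel G.Adj] (w : V → V → ℝ)
    (hw_symm : ∀ i j, w i j = w j i) (hw_pos : ∀ i j, G.Adj i j → 0 < w i j)
    (R : V → V → ℝ) (hR : IsEdgeFlow G R) :
    ∃ Φ₀ : V → V → V → ℝ, ∃ X₀ : V → V → ℝ,
      IsTriFlow G Φ₀ ∧
      IsEdgeFlow G X₀ ∧ (∀ i j, G.Adj i j → |X₀ i j| ≤ (w i j)⁻¹) ∧
      curlFlow G X₀ = 0 ∧
      (∀ Φ : V → V → V → ℝ, IsTriFlow G Φ →
        sparseL1Obj G w R Φ₀ ≤ sparseL1Obj G w R Φ) ∧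
      (∀ X : V → V → ℝ, IsEdgeFlow G X → (∀ i j, G.Adj i j → |X i j| ≤ (w i j)⁻¹) →
        curlFlow G X = 0 → innerW G w X R ≤ innerW G w X₀ R) ∧
      sparseL1Obj G w R Φ₀ = innerW G w X₀ R := by
  obtain ⟨s, ⟨Φ₀, hΦ₀, hs⟩, c, hc, hc_zero, hc_eq⟩ :=
    exists_l1_dual_certificate (curlStarSubmodule G w) fun p => R p.1 p.2
  have hX := isEdgeFlow_rieszFlow (G := G) hw_symm fun i j => c (i, j)
  have hX_le (i j : V) (h : G.Adj i j) := abs_rieszFlow_le (w := w)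
    (c := fun i j => c (i, j)) (fun i j => hc (i, j)) h (hw_pos i j h)
  have hcurl : curlFlow G (rieszFlow G w fun i j => c (i, j)) = 0 := by
    refine curlFlow_eq_zero_of_innerW_curlStar hw_pos hX ?_
    rw [innerW_rieszFlow hw_pos _ (hX.curlFlow.curlStar hw_symm)]
    have h := hc_zero _ ⟨_, hX.curlFlow, fun _ => rfl⟩
    rw [Fintype.sum_prod_type] at h
    rw [h, mul_zero]
  have heq : sparseL1Obj G w R Φ₀ = innerW G w (rieszFlow G w fun i j => c (i, j)) R := by
    rw [innerW_rieszFlow hw_pos _ hR, sparseL1Obj]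
    simp only [Fintype.sum_prod_type, hs] at hc_eq
    rw [hc_eq]
    congr 1
    refine sum_congr rfl fun i _ => sum_congr rfl fun j _ => ?_
    split_ifs with h
    · rfl
    · simp [curlStar, h, hR.2 i j h]
  refine ⟨Φ₀, _, hΦ₀, hX, hX_le, hcurl, fun Φ hΦ => ?_, fun X _ hX' hcurl' => ?_, heq⟩
  · exact heq.trans_le (innerW_le_sparseL1Obj hw_pos R hΦ hX_le hcurl)
  · exact (innerW_le_sparseL1Obj hw_pos R hΦ₀ hX' hcurl').trans_eq heq
end

section
/- Let n ≥ 3 and let X : {1,…,n}×{1,…,n} → ℝ be skew-symmetric with X(i,j) ∈ {−1,1} for all i ≠ j (a binary pairwise ranking on a complete comparison graph). Then for all distinct i,j,k, |X(i,j) + X(j,k) + X(k,i)| ∈ {1,3}, and the number N of 3-element subsets {i,j,k} that form a circular triad, i.e., with |X(i,j) + X(j,k) + X(k,i)| = 3, is given by N = n(n² − 1)/24 − (1/8) Σ_{i=1}^n (Σ_{j=1}^n X(i,j))². -/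
open Finset

/-- A function of triples that is symmetric and vanishes on triples with a repetition sums to six
times its sum over increasing triples. -/
lemma sum_triples_eq_six_mul {ι : Type*} [Fintype ι] [LinearOrder ι] (g : ι → ι → ι → ℝ)
    (hswap : ∀ i j k, g i j k = g j i k) (hrot : ∀ i j k, g i j k = g j k i)
    (hdiag : ∀ i k, g i i k = 0) :
    ∑ i, ∑ j, ∑ k, g i j k = 6 * ∑ i, ∑ j, ∑ k, if i < j ∧ j < k then g i j k else 0 := by
  set h : ι → ι → ι → ℝ := fun i j k => if i < j ∧ j < k then g i j k else 0 with hh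
  have key : ∀ i j k,
      g i j k = h i j k + h i k j + h j i k + h j k i + h k i j + h k j i := by
    intro i j k
    have e1 : g i k j = g i j k := (hswap i k j).trans (hrot k i j)
    have e2 : g k j i = g i j k := (hswap k j i).trans (hrot i j k).symm
    have hzero : i = j ∨ j = k ∨ i = k → g i j k = 0 := by
      rintro (rfl | rfl | rfl)
      · exact hdiag _ _
      · rw [hrot, hdiag]
      · rw [← e1, hdiag]
    simp only [hh, e1, e2, ← hswap i j k, ← hrot i j k, hrot k i j]
    generalize g i j k = x at hzero
    rcases lt_trichotomy i j with a | a | a <;> rcases lt_trichotomy j k with b | b | b <;>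
      rcases lt_trichotomy i k with c | c | c <;> grind
  change _ = 6 * ∑ i, ∑ j, ∑ k, h i j k
  clear_value h
  have swap12 : ∀ f : ι → ι → ι → ℝ, ∑ i, ∑ j, ∑ k, f j i k = ∑ i, ∑ j, ∑ k, f i j k :=
    fun f => sum_comm
  have swap23 : ∀ f : ι → ι → ι → ℝ, ∑ i, ∑ j, ∑ k, f i k j = ∑ i, ∑ j, ∑ k, f i j k :=
    fun f => sum_congr rfl fun i _ => sum_comm
  have s1 := swap23 h
  have s2 := swap12 h
  have s3 : ∑ i, ∑ j, ∑ k, h j k i = ∑ i, ∑ j, ∑ k, h i j k :=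
    (swap12 fun i j k => h i k j).trans s1
  have s4 : ∑ i, ∑ j, ∑ k, h k i j = ∑ i, ∑ j, ∑ k, h i j k :=
    (swap23 fun i j k => h j i k).trans s2
  have s5 : ∑ i, ∑ j, ∑ k, h k j i = ∑ i, ∑ j, ∑ k, h i j k :=
    (swap12 fun i j k => h k i j).trans s4
  simp_rw [key, sum_add_distrib, s1, s2, s3, s4, s5]
  ring

/-- The indicator of a circular triad is a quadratic polynomial in the pairwise rankings. -/
lemma four_mul_circular_indicator {ι : Type*} [DecidableEq ι] (X : ι → ι → ℝ)
    (hskew : ∀ i j, X i j = - X j i) (hbin : ∀ i j, i ≠ j → X i j = -1 ∨ X i j = 1)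
    (i j k : ι) :
    4 * (if |X i j + X j k + X k i| = 3 then (1 : ℝ) else 0) =
      1 - (if i = j then if j = k then 1 else 0 else 0) +
        (X i j * X j k + X j k * X k i + X k i * X i j) := by
  have hself : ∀ i, X i i = 0 := fun i => by linarith [hskew i i]
  by_cases hij : i = j
  · subst hij
    by_cases hik : i = k
    · subst hik
      simp [hself]
    · rw [hskew k i]
      rcases hbin i k hik with h | h <;> simp [hself, h, hik]
  · by_cases hjk : j = k
    · subst hjk
      rw [hskew j i]
      rcases hbin i j hij with h | h <;> simp [hself, h, hij]
    · by_cases hik : i = k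
      · subst hik
        rw [hskew j i]
        rcases hbin i j hij with h | h <;> simp [hself, h, hij]
      · rw [hskew k i]
        rcases hbin i j hij with h | h <;> rcases hbin j k hjk with h' | h' <;>
          rcases hbin i k hik with h'' | h'' <;> rw [h, h', h''] <;> norm_num [hij]

/-- The sum of the products of consecutive edges over all triples, for a skew-symmetric function. -/
lemma sum_mul_cyclic_of_skew {ι : Type*} [Fintype ι] (X : ι → ι → ℝ)
    (hskew : ∀ i j, X i j = - X j i) :
    ∑ i, ∑ j, ∑ k, (X i j * X j k + X j k * X k i + X k i * X i j) =
      -3 * ∑ i, (∑ j, X i j) ^ 2 := by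
  have path : ∀ j, ∑ i, ∑ k, X i j * X j k = -(∑ k, X j k) ^ 2 := fun j => by
    rw [← sum_mul_sum, sum_congr rfl fun i _ => hskew i j, sum_neg_distrib]
    ring
  have h1 : ∑ i, ∑ j, ∑ k, X i j * X j k = -∑ i, (∑ j, X i j) ^ 2 := by
    rw [sum_comm, sum_congr rfl fun j _ => path j, sum_neg_distrib]
  have h2 : ∑ i, ∑ j, ∑ k, X j k * X k i = -∑ i, (∑ j, X i j) ^ 2 := by
    rw [← h1, sum_comm]
    exact sum_congr rfl fun i _ => sum_comm
  have h3 : ∑ i, ∑ j, ∑ k, X k i * X i j = -∑ i, (∑ j, X i j) ^ 2 := by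
    rw [← sum_neg_distrib]
    exact sum_congr rfl fun i _ => sum_comm.trans (path i)
  simp_rw [sum_add_distrib, h1, h2, h3]
  ring

/-- For a binary pairwise ranking `X` on a complete comparison graph (skew-symmetric
with off-diagonal entries `±1`), the curl of every triangle has absolute value `1` or
`3`, and the number `N` of circular triads (3-subsets, represented by ordered triples
`i < j < k`, whose curl has absolute value `3`) satisfies Kendall–Smith's formula
`N = n(n²−1)/24 − (1/8) Σᵢ (Σⱼ X i j)²`. -/
theorem circular_triads_count {n : ℕ} (hn : 3 ≤ n)
    (X : Fin n → Fin n → ℝ) (hskew : ∀ i j, X i j = - X j i)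
    (hbin : ∀ i j, i ≠ j → X i j = -1 ∨ X i j = 1) :
    (∀ i j k : Fin n, i ≠ j → j ≠ k → i ≠ k →
      |X i j + X j k + X k i| = 1 ∨ |X i j + X j k + X k i| = 3) ∧
    (({t : Fin n × Fin n × Fin n | t.1 < t.2.1 ∧ t.2.1 < t.2.2 ∧
        |X t.1 t.2.1 + X t.2.1 t.2.2 + X t.2.2 t.1| = 3}.ncard : ℝ) =
      (n : ℝ) * ((n : ℝ) ^ 2 - 1) / 24 -
        (1 / 8) * ∑ i, (∑ j, X i j) ^ 2) := by
  constructor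
  · intro i j k hij hjk hik
    rcases hbin i j hij with h | h <;> rcases hbin j k hjk with h' | h' <;>
      rcases hbin k i hik.symm with h'' | h'' <;> rw [h, h', h''] <;> norm_num
  · classical
    have hself : ∀ i, X i i = 0 := fun i => by linarith [hskew i i]
    set g : Fin n → Fin n → Fin n → ℝ :=
      fun i j k => if |X i j + X j k + X k i| = 3 then 1 else 0 with hg
    have hN : ({t : Fin n × Fin n × Fin n | t.1 < t.2.1 ∧ t.2.1 < t.2.2 ∧
        |X t.1 t.2.1 + X t.2.1 t.2.2 + X t.2.2 t.1| = 3}.ncard : ℝ) =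
        ∑ i, ∑ j, ∑ k, if i < j ∧ j < k then g i j k else 0 := by
      rw [Set.ncard_eq_toFinset_card', Set.toFinset_ofPred, card_filter, Nat.cast_sum,
        Fintype.sum_prod_type]
      refine sum_congr rfl fun i _ => ?_
      rw [Fintype.sum_prod_type]
      refine sum_congr rfl fun j _ => sum_congr rfl fun k _ => ?_
      simp only [hg, ← and_assoc, ite_and, Nat.cast_ite, Nat.cast_one, Nat.cast_zero]
    have hsix : ∑ i, ∑ j, ∑ k, g i j k = _ := sum_triples_eq_six_mul g
      (fun i j k => by
        have : X j i + X i k + X k j = -(X i j + X j k + X k i) := by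
          linarith [hskew i j, hskew j k, hskew k i]
        simp only [hg, this, abs_neg])
      (fun i j k => by
        have : X j k + X k i + X i j = X i j + X j k + X k i := by ring
        simp only [hg, this])
      (fun i k => by simp [hg, hself, hskew k i])
    have hsum : 4 * ∑ i, ∑ j, ∑ k, g i j k =
        (n : ℝ) ^ 3 - n + -3 * ∑ i, (∑ j, X i j) ^ 2 := by
      rw [← sum_mul_cyclic_of_skew X hskew]
      simp_rw [mul_sum, hg, four_mul_circular_indicator X hskew hbin]
      simp only [sum_add_distrib, sum_sub_distrib]
      congr 2
      · simp
        ring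
      · have hdelta : ∀ i j : Fin n, ∑ k, (if i = j then if j = k then (1 : ℝ) else 0 else 0) =
            if i = j then 1 else 0 := fun i j => by
          split_ifs <;> simp
        simp [hdelta]
    rw [hN]
    linarith
end
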